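/- arXiv:2309.05340 — 2 statements merged into one kernel-verified Lean document; each statement's English description precedes it below -/
import Mathlib

section
/- Let i, j, k ∈ [n] be such that i ≤ k < j − 1. Then in k[S_n] we have [t_i, t_j] · μ_{k,j} = μ_{k+1,j} · [t_i, t_{j−1}]. -/
/-- The simple transposition `s_i ∈ S_n` (1-based indexing), swapping `i` and `i+1`,
defined as the identity for `i` outside `{1, …, n-1}`. -/
def simpleTransposition (n i : ℕ) : Equiv.Perm (Fin n) :=
  if h : 1 ≤ i ∧ i < n then
    Equiv.swap ⟨i - 1, by omega⟩ ⟨i, h.2⟩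
  else 1

/-- The cycle `(v ⟹ w) = s_v s_{v+1} ⋯ s_{w-1} ∈ S_n`, sending
`v ↦ v+1 ↦ ⋯ ↦ w ↦ v` (and equal to the identity when `v = w`). -/
def cyc (n v w : ℕ) : Equiv.Perm (Fin n) :=
  ((List.range' v (w - v)).map (simpleTransposition n)).prod

/-- The somewhere-to-below shuffle `t_ℓ = Σ_{w=ℓ}^{n} (ℓ ⟹ w)` in the group
algebra `R[S_n]`. -/
noncomputable def t (R : Type*) [CommRing R] (n ℓ : ℕ) :
    MonoidAlgebra R (Equiv.Perm (Fin n)) :=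
  ∑ w ∈ Finset.Icc ℓ n, MonoidAlgebra.of R (Equiv.Perm (Fin n)) (cyc n ℓ w)

/-- The element `μ_{i,j} = (i ⟹ j-1) · t_{j-1}` of the group algebra `R[S_n]`. -/
noncomputable def mu (R : Type*) [CommRing R] (n i j : ℕ) :
    MonoidAlgebra R (Equiv.Perm (Fin n)) :=
  MonoidAlgebra.of R (Equiv.Perm (Fin n)) (cyc n i (j - 1)) * t R n (j - 1)

theorem simpleTransposition_mul_self (n i : ℕ) :
    simpleTransposition n i * simpleTransposition n i = 1 := by
  unfold simpleTransposition
  split_ifs <;> simp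

theorem commute_simpleTransposition {n i j : ℕ} (h : i + 1 < j) :
    Commute (simpleTransposition n i) (simpleTransposition n j) := by
  unfold simpleTransposition
  split_ifs with h₁ h₂
  · refine (Equiv.Perm.disjoint_iff_disjoint_support.2 ?_).commute
    rw [Equiv.Perm.support_swap (by simp; omega), Equiv.Perm.support_swap (by simp; omega)]
    simp
    omega
  · exact Commute.one_right _
  · exact Commute.one_left _
  · exact Commute.one_left _

theorem simpleTransposition_braid {n i : ℕ} (hi : 1 ≤ i) (hn : i + 1 < n) :
    simpleTransposition n i * simpleTransposition n (i + 1) * simpleTransposition n i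
      = simpleTransposition n (i + 1) * simpleTransposition n i
        * simpleTransposition n (i + 1) := by
  have h₁ : 1 ≤ i ∧ i < n := ⟨hi, by omega⟩
  have h₂ : 1 ≤ i + 1 ∧ i + 1 < n := ⟨by omega, hn⟩
  simp only [simpleTransposition, dif_pos h₁, dif_pos h₂]
  ext x
  simp only [Equiv.Perm.mul_apply, Equiv.swap_apply_def, Fin.ext_iff]
  grind

theorem cyc_self (n v : ℕ) : cyc n v v = 1 := by
  simp [cyc]

theorem cyc_mul_cyc {n u v w : ℕ} (huv : u ≤ v) (hvw : v ≤ w) :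
    cyc n u v * cyc n v w = cyc n u w := by
  obtain ⟨a, rfl⟩ := Nat.exists_eq_add_of_le huv
  obtain ⟨b, rfl⟩ := Nat.exists_eq_add_of_le hvw
  have h : u + a + b - u = a + b := by omega
  simp only [cyc, h, Nat.add_sub_cancel_left, ← List.prod_append, ← List.map_append,
    List.range'_append_1]

theorem cyc_succ_self (n v : ℕ) : cyc n v (v + 1) = simpleTransposition n v := by
  simp [cyc]

theorem simpleTransposition_mul_cyc {n v w : ℕ} (h : v < w) :
    simpleTransposition n v * cyc n (v + 1) w = cyc n v w := by
  rw [← cyc_succ_self, cyc_mul_cyc (by omega) h]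

theorem cyc_mul_simpleTransposition {n v w : ℕ} (h : v ≤ w) :
    cyc n v w * simpleTransposition n w = cyc n v (w + 1) := by
  rw [← cyc_succ_self, cyc_mul_cyc h (by omega)]

theorem commute_simpleTransposition_cyc_of_lt {n i v w : ℕ} (h : i + 1 < v) :
    Commute (simpleTransposition n i) (cyc n v w) := by
  refine Commute.list_prod_right _ _ fun x hx => ?_
  obtain ⟨a, ha, rfl⟩ := List.mem_map.1 hx
  rw [List.mem_range'_1] at ha
  exact commute_simpleTransposition (by omega)

theorem commute_simpleTransposition_cyc_of_gt {n i v w : ℕ} (h : w < i) :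
    Commute (simpleTransposition n i) (cyc n v w) := by
  refine Commute.list_prod_right _ _ fun x hx => ?_
  obtain ⟨a, ha, rfl⟩ := List.mem_map.1 hx
  rw [List.mem_range'_1] at ha
  exact (commute_simpleTransposition (by omega)).symm

theorem cyc_mul_simpleTransposition_eq {n v w a : ℕ} (hv : 1 ≤ v) (hw : w ≤ n)
    (hva : v ≤ a) (haw : a + 1 < w) :
    cyc n v w * simpleTransposition n a = simpleTransposition n (a + 1) * cyc n v w := by
  have h : cyc n v w = cyc n v a * (simpleTransposition n a * simpleTransposition n (a + 1))
      * cyc n (a + 2) w := by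
    rw [← mul_assoc, cyc_mul_simpleTransposition hva, cyc_mul_simpleTransposition (by omega),
      cyc_mul_cyc (by omega) (by omega)]
  have h₁ : Commute (simpleTransposition n a) (cyc n (a + 2) w) :=
    commute_simpleTransposition_cyc_of_lt (by omega)
  have h₂ : Commute (simpleTransposition n (a + 1)) (cyc n v a) :=
    commute_simpleTransposition_cyc_of_gt (by omega)
  rw [h, mul_assoc, ← h₁.eq]
  simp only [← mul_assoc]
  rw [h₂.eq]
  simpa only [mul_assoc] using congrArg (cyc n v a * · * cyc n (a + 2) w)
    (simpleTransposition_braid (n := n) (i := a) (by omega) (by omega))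

theorem cyc_mul_cyc_comm {n v w k m : ℕ} (hv : 1 ≤ v) (hw : w ≤ n) (hvk : v ≤ k)
    (hkm : k ≤ m) (hmw : m < w) :
    cyc n v w * cyc n k m = cyc n (k + 1) (m + 1) * cyc n v w := by
  induction m, hkm using Nat.le_induction with
  | base => simp [cyc_self]
  | succ m hkm ih =>
    rw [← cyc_mul_simpleTransposition hkm, ← cyc_mul_simpleTransposition (by omega), ← mul_assoc,
      ih (by omega), mul_assoc, cyc_mul_simpleTransposition_eq hv hw (by omega) hmw, mul_assoc]

section GroupAlgebra

variable (R : Type*) [CommRing R]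

theorem t_eq_zero {n l : ℕ} (h : n < l) : t R n l = 0 := by
  simp [t, Finset.Icc_eq_empty_of_lt h]

theorem t_eq_one_add {n l : ℕ} (h : l ≤ n) :
    t R n l = 1 + MonoidAlgebra.of R _ (simpleTransposition n l) * t R n (l + 1) := by
  rw [t, t, ← Finset.insert_Icc_add_one_left_eq_Icc h, Finset.sum_insert (by simp), cyc_self,
    map_one, Finset.mul_sum]
  congr 1
  refine Finset.sum_congr rfl fun w hw => ?_
  rw [← map_mul, simpleTransposition_mul_cyc (Finset.mem_Icc.1 hw).1]

theorem commute_simpleTransposition_t {n i l : ℕ} (h : i + 1 < l) :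
    Commute (MonoidAlgebra.of R _ (simpleTransposition n i)) (t R n l) :=
  Commute.sum_right _ _ _ fun _ _ => (commute_simpleTransposition_cyc_of_lt h).map _

theorem commute_cyc_t {n v w l : ℕ} (h : w < l) :
    Commute (MonoidAlgebra.of R _ (cyc n v w)) (t R n l) := by
  rw [cyc, map_list_prod, List.map_map]
  refine Commute.list_prod_left _ _ fun x hx => ?_
  obtain ⟨a, ha, rfl⟩ := List.mem_map.1 hx
  rw [List.mem_range'_1] at ha
  exact commute_simpleTransposition_t R (by omega)

theorem simpleTransposition_mul_t_mul_t {n l : ℕ} (hl : 1 ≤ l) :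
    MonoidAlgebra.of R _ (simpleTransposition n l) * (t R n (l + 1) * t R n l)
      = t R n (l + 1) * t R n l := by
  by_cases hn : l + 1 ≤ n
  · have ih := simpleTransposition_mul_t_mul_t (n := n) (l := l + 1) (by omega)
    have hU := t_eq_one_add R (n := n) (l := l) (by omega)
    have hT := t_eq_one_add R hn
    have hss := congrArg (MonoidAlgebra.of R _) (simpleTransposition_mul_self n l)
    have hc := (commute_simpleTransposition_t R (n := n) (i := l) (l := l + 2) (by omega)).eq
    rw [map_mul, map_one] at hss
    have hb : t R n (l + 2) = 0 ∨
        MonoidAlgebra.of R _ (simpleTransposition n l)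
          * MonoidAlgebra.of R _ (simpleTransposition n (l + 1))
          * MonoidAlgebra.of R _ (simpleTransposition n l)
        = MonoidAlgebra.of R _ (simpleTransposition n (l + 1))
          * MonoidAlgebra.of R _ (simpleTransposition n l)
          * MonoidAlgebra.of R _ (simpleTransposition n (l + 1)) := by
      rcases Nat.lt_or_ge n (l + 2) with h | h
      · exact .inl (t_eq_zero R h)
      · right
        simpa only [map_mul] using
          congrArg (MonoidAlgebra.of R _) (simpleTransposition_braid hl (by omega))
    generalize MonoidAlgebra.of R _ (simpleTransposition n l) = s at *
    generalize MonoidAlgebra.of R _ (simpleTransposition n (l + 1)) = r at *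
    rw [show l + 1 + 1 = l + 2 from rfl] at *
    generalize t R n (l + 2) = V at *
    generalize t R n (l + 1) = T at *
    generalize t R n l = U at *
    have hTU : T * U = (1 + s) + (1 + s) * (r * V) + r * s * (V * T) := by
      have h : T * U = T + (s + r * (V * s)) * T := by rw [hU, hT]; noncomm_ring
      rw [h, ← hc, hT]
      noncomm_ring
    have hs : s * (1 + s) = 1 + s := by rw [mul_add, hss, mul_one, add_comm]
    have hX : s * (r * s * (V * T)) = r * s * (V * T) := by
      rcases hb with rfl | hb
      · simp
      · rw [← mul_assoc, ← mul_assoc s r s, hb, mul_assoc, ih]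
    rw [hTU, mul_add, mul_add, hX, ← mul_assoc s (1 + s), hs]
  · simp [t_eq_zero R (show n < l + 1 by omega)]
termination_by n - l

theorem t_succ_mul_t {n l : ℕ} (hl : 1 ≤ l) (hn : l ≤ n) :
    t R n (l + 1) * t R n l = t R n l * t R n l - t R n l := by
  rw [← simpleTransposition_mul_t_mul_t R hl, ← mul_assoc,
    eq_sub_of_add_eq' (t_eq_one_add R hn).symm, sub_one_mul]

theorem comm_t_eq_cyc_mul {n i l : ℕ} (hil : i ≤ l) (hl : l ≤ n) :
    t R n i * t R n (l + 1) - t R n (l + 1) * t R n i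
      = MonoidAlgebra.of R _ (cyc n i l)
        * (t R n l * t R n (l + 1) - t R n (l + 1) * t R n l) := by
  induction hil using Nat.decreasingInduction with
  | self => rw [cyc_self, map_one, one_mul]
  | of_succ i hi ih =>
    have hc := (commute_simpleTransposition_t R (n := n) (i := i) (l := l + 1) (by omega)).eq
    rw [← simpleTransposition_mul_cyc hi, map_mul, mul_assoc, ← ih, t_eq_one_add R (by omega),
      mul_add, ← mul_assoc (t R n (l + 1)), ← hc]
    noncomm_ring

theorem simpleTransposition_mul_t_mul_comm {n l : ℕ} (hl : 1 ≤ l) (hn : l ≤ n) :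
    MonoidAlgebra.of R _ (simpleTransposition n l) * (t R n (l + 1)
        * (t R n l * t R n (l + 1) - t R n (l + 1) * t R n l))
      = t R n (l + 1) * (t R n l * t R n (l + 1) - t R n (l + 1) * t R n l) := by
  have h := simpleTransposition_mul_t_mul_t R (n := n) hl
  have hUA := t_succ_mul_t R hl hn
  have hA := t_eq_one_add R hn
  generalize MonoidAlgebra.of R _ (simpleTransposition n l) = r at *
  generalize t R n (l + 1) = U at *
  generalize t R n l = A at *
  have h' : U * (A * U - U * A) = U * A * U - U * A * A + U * A := by
    rw [hUA, mul_sub, mul_sub, ← mul_assoc, ← mul_assoc, hUA]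
    noncomm_ring
  rw [h', mul_add, mul_sub]
  simp only [← mul_assoc] at h ⊢
  rw [h]

theorem comm_t_mul_simpleTransposition_mul_t {n l : ℕ} (hl : 1 ≤ l) (hn : l + 1 ≤ n) :
    (t R n (l + 1) * t R n (l + 2) - t R n (l + 2) * t R n (l + 1))
        * (MonoidAlgebra.of R _ (simpleTransposition n l) * t R n (l + 1))
      = t R n (l + 1) * (t R n l * t R n (l + 1) - t R n (l + 1) * t R n l) := by
  have hTU := t_succ_mul_t R (n := n) (l := l + 1) (by omega) hn
  have hA := t_eq_one_add R (n := n) (l := l) (by omega)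
  have hc := (commute_simpleTransposition_t R (n := n) (i := l) (l := l + 2) (by omega)).eq
  rw [show l + 1 + 1 = l + 2 from rfl] at *
  generalize MonoidAlgebra.of R _ (simpleTransposition n l) = r at *
  generalize t R n (l + 2) = T at *
  generalize t R n (l + 1) = U at *
  generalize t R n l = A at *
  have h : U * T * (r * U) = U * (r * (T * U)) := by
    rw [mul_assoc, ← mul_assoc T, ← hc, mul_assoc r]
  rw [sub_mul, h, hTU, hA]
  noncomm_ring

end GroupAlgebra

theorem comm_ti_tj_mul_mu
    (R : Type*) [CommRing R] (n : ℕ) (hn : 0 < n)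
    (i j k : ℕ) (hi1 : 1 ≤ i) (hin : i ≤ n) (hj1 : 1 ≤ j) (hjn : j ≤ n)
    (hk1 : 1 ≤ k) (hkn : k ≤ n) (hik : i ≤ k) (hkj : k < j - 1) :
    (t R n i * t R n j - t R n j * t R n i) * mu R n k j
      = mu R n (k + 1) j * (t R n i * t R n (j - 1) - t R n (j - 1) * t R n i) := by
  obtain ⟨m, rfl⟩ : ∃ m, j = m + 2 := ⟨j - 2, by omega⟩
  have hkm : k ≤ m := by omega
  have hc : Commute (MonoidAlgebra.of R _ (cyc n k m)) _ :=
    ((commute_cyc_t R (l := m + 1) (by omega)).mul_right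
      (commute_cyc_t R (l := m + 2) (by omega))).sub_right
    ((commute_cyc_t R (l := m + 2) (by omega)).mul_right
      (commute_cyc_t R (l := m + 1) (by omega)))
  simp only [mu, show m + 2 - 1 = m + 1 from rfl]
  rw [comm_t_eq_cyc_mul R (l := m + 1) (by omega) (by omega),
    comm_t_eq_cyc_mul R (l := m) (by omega) (by omega),
    ← cyc_mul_simpleTransposition hkm, map_mul, mul_assoc, mul_assoc _ _ (t R n (m + 1)),
    ← mul_assoc _ (MonoidAlgebra.of R _ (cyc n k m)), ← hc.eq, mul_assoc _ _ (_ * _),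
    comm_t_mul_simpleTransposition_mul_t R (by omega) (by omega), ← mul_assoc, ← map_mul,
    cyc_mul_cyc_comm hi1 (by omega) hik hkm (by omega),
    ← cyc_mul_simpleTransposition (v := i) (w := m) (by omega), map_mul, map_mul, mul_assoc,
    mul_assoc, simpleTransposition_mul_t_mul_comm R (by omega) (by omega),
    ← mul_assoc (MonoidAlgebra.of R _ (cyc n i m)),
    (commute_cyc_t R (v := i) (show m < m + 1 by omega)).eq]
  simp only [mul_assoc]
end

section
/- Let i, j, v, w ∈ [n] be such that w ≥ v > j ≥ i. Then in the symmetric group S_n we have (j+1 ⟹ v) · (i ⟹ w) = (i ⟹ w) · (j ⟹ v−1). -/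
theorem simpleTransposition_val {n i : ℕ} (hi : 1 ≤ i) (hin : i < n) (x : Fin n) :
    (simpleTransposition n i x : ℕ) =
      if (x : ℕ) + 1 = i then i else if (x : ℕ) = i then i - 1 else x := by
  rw [simpleTransposition, dif_pos ⟨hi, hin⟩, Equiv.swap_apply_def]
  simp only [Fin.ext_iff, apply_ite Fin.val]
  split_ifs <;> omega

theorem cyc_succ {n v w : ℕ} (h : v ≤ w) :
    cyc n v (w + 1) = cyc n v w * simpleTransposition n w := by
  obtain ⟨d, rfl⟩ := Nat.exists_eq_add_of_le h
  have h1 : v + d + 1 - v = d + 1 := by omega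
  have h2 : v + d - v = d := by omega
  simp [cyc, h1, h2, List.range'_concat]

/-- The underlying value of `cyc n v w x`, where `x : Fin n` represents the element `x + 1`
of `{1, …, n}`. -/
theorem cyc_val {n v w : ℕ} (hv : 1 ≤ v) (hvw : v ≤ w) (hwn : w ≤ n) (x : Fin n) :
    (cyc n v w x : ℕ) =
      if (x : ℕ) + 1 < v ∨ w < (x : ℕ) + 1 then (x : ℕ)
      else if (x : ℕ) + 1 = w then v - 1 else x + 1 := by
  induction w, hvw using Nat.le_induction generalizing x with
  | base =>
    rw [cyc_self, Equiv.Perm.one_apply]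
    split_ifs <;> omega
  | succ w hvw ih =>
    rw [cyc_succ hvw, Equiv.Perm.mul_apply, ih (by omega),
      simpleTransposition_val (by omega) (by omega)]
    split_ifs <;> omega

theorem cyc_mul_cyc_rewrite
    (n : ℕ) (hn : 0 < n)
    (i j v w : ℕ) (hi1 : 1 ≤ i) (hin : i ≤ n) (hj1 : 1 ≤ j) (hjn : j ≤ n)
    (hv1 : 1 ≤ v) (hvn : v ≤ n) (hw1 : 1 ≤ w) (hwn : w ≤ n)
    (hwv : w ≥ v) (hvj : v > j) (hji : j ≥ i) :
    cyc n (j + 1) v * cyc n i w = cyc n i w * cyc n j (v - 1) := by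
  ext x
  rw [Equiv.Perm.mul_apply, Equiv.Perm.mul_apply,
    cyc_val (by omega) (by omega) hvn, cyc_val hi1 (by omega) hwn,
    cyc_val hi1 (by omega) hwn, cyc_val hj1 (by omega) (by omega)]
  split_ifs <;> omega
end
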